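/- Let R be a G-graded domain. If the homogeneous localization R_(𝔪) is a graded perinormal domain for every graded maximal ideal 𝔪 of R, then R is a graded perinormal domain. Conversely, if R is a graded perinormal domain, then R_W is a graded perinormal domain for every multiplicative subset W of R consisting of homogeneous elements. -/

import Mathlib

/-! Core definitions for graded perinormality, following Epstein–Shapiro style graded notions. -/

section Core

variable {ι : Type*} [DecidableEq ι] [AddCommMonoid ι]
variable {R : Type*} [CommRing R]

/-- `𝒜` is a grading of the ring `R` by the (torsionless) monoid `ι`:
the components multiply correctly and give an internal direct sum decomposition. -/
structure IsGrRing (𝒜 : ι → AddSubgroup R) : Prop where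
  one_mem : (1 : R) ∈ 𝒜 0
  mul_mem : ∀ {i j : ι} {a b : R}, a ∈ 𝒜 i → b ∈ 𝒜 j → a * b ∈ 𝒜 (i + j)
  internal : DirectSum.IsInternal 𝒜

/-- An ideal of `R` is homogeneous iff every element of it is a finite sum of
homogeneous elements of the ideal. -/
def IsHomIdeal (𝒜 : ι → AddSubgroup R) (I : Ideal R) : Prop :=
  ∀ x ∈ I, x ∈ AddSubmonoid.closure {y : R | SetLike.IsHomogeneousElem 𝒜 y ∧ y ∈ I}

/-- A graded (homogeneous) maximal ideal: maximal among proper homogeneous ideals. -/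
def IsGrMaxIdeal (𝒜 : ι → AddSubgroup R) (I : Ideal R) : Prop :=
  IsHomIdeal 𝒜 I ∧ I ≠ ⊤ ∧ ∀ J : Ideal R, IsHomIdeal 𝒜 J → I ≤ J → J ≠ ⊤ → J = I

/-- `R` is gr-local: it has exactly one graded maximal ideal. -/
def GrLocal (𝒜 : ι → AddSubgroup R) : Prop :=
  ∃! I : Ideal R, IsGrMaxIdeal 𝒜 I

/-- A prime ideal of height one (in a domain). -/
def HeightOnePrime (P : Ideal R) : Prop :=
  P.IsPrime ∧ P ≠ ⊥ ∧ ∀ Q : Ideal R, Q.IsPrime → Q < P → Q = ⊥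

variable [IsDomain R]

/-- A homogeneous element of the graded quotient field of `R`, i.e. a quotient of two
homogeneous elements of `R` (viewed inside the full quotient field). -/
def IsHomFrac (𝒜 : ι → AddSubgroup R) (x : FractionRing R) : Prop :=
  ∃ (i j : ι) (a b : R), a ∈ 𝒜 i ∧ b ∈ 𝒜 j ∧ b ≠ 0 ∧
    x * algebraMap R (FractionRing R) b = algebraMap R (FractionRing R) a

/-- `S` is a graded overring of `R`: a ring between `R` and the graded quotient field that is
the sum of its homogeneous components, i.e. each of its elements is a finite sum of
homogeneous elements of `S`. -/
def IsGradedOverring (𝒜 : ι → AddSubgroup R) (S : Subalgebra R (FractionRing R)) : Prop :=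
  ∀ x ∈ S, x ∈ AddSubmonoid.closure {y : FractionRing R | y ∈ S ∧ IsHomFrac 𝒜 y}

/-- A homogeneous ideal of an overring `S` of `R`. -/
def IsHomIdealOver (𝒜 : ι → AddSubgroup R) (S : Subalgebra R (FractionRing R))
    (I : Ideal S) : Prop :=
  ∀ x ∈ I, (x : FractionRing R) ∈ AddSubmonoid.closure
    {y : FractionRing R | IsHomFrac 𝒜 y ∧ ∃ h : y ∈ S, (⟨y, h⟩ : S) ∈ I}

/-- A graded maximal ideal of an overring. -/
def IsGrMaxIdealOver (𝒜 : ι → AddSubgroup R) (S : Subalgebra R (FractionRing R))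
    (I : Ideal S) : Prop :=
  IsHomIdealOver 𝒜 S I ∧ I ≠ ⊤ ∧
    ∀ J : Ideal S, IsHomIdealOver 𝒜 S J → I ≤ J → J ≠ ⊤ → J = I

/-- The overring `S` is gr-local. -/
def GrLocalOver (𝒜 : ι → AddSubgroup R) (S : Subalgebra R (FractionRing R)) : Prop :=
  ∃! I : Ideal S, IsGrMaxIdealOver 𝒜 S I

/-- `S` satisfies graded going-down (gGD) over `R`. -/
def GGD (𝒜 : ι → AddSubgroup R) (S : Subalgebra R (FractionRing R)) : Prop :=
  ∀ (P Q : Ideal R) (Qt : Ideal S), P.IsPrime → Q.IsPrime → Qt.IsPrime →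
    IsHomIdeal 𝒜 P → IsHomIdeal 𝒜 Q → IsHomIdealOver 𝒜 S Qt → P ≤ Q →
    Qt.comap (algebraMap R S) = Q →
    ∃ Pt : Ideal S, Pt.IsPrime ∧ IsHomIdealOver 𝒜 S Pt ∧ Pt ≤ Qt ∧
      Pt.comap (algebraMap R S) = P

/-- The overring `S` is a localization of `R` (at some multiplicative subset `W` of `R`). -/
def IsLocalizationOfR (S : Subalgebra R (FractionRing R)) : Prop :=
  ∃ W : Submonoid R, (∀ w ∈ W, IsUnit (algebraMap R S w)) ∧
    ∀ s : S, ∃ (r w : R), w ∈ W ∧ s * algebraMap R S w = algebraMap R S r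

/-- `R` is a graded perinormal domain: every gr-local graded overring satisfying gGD is a
localization of `R`. -/
def GradedPerinormal (𝒜 : ι → AddSubgroup R) : Prop :=
  ∀ S : Subalgebra R (FractionRing R),
    IsGradedOverring 𝒜 S → GrLocalOver 𝒜 S → GGD 𝒜 S → IsLocalizationOfR S

/-- `R` is a graded globally perinormal domain: every graded overring satisfying gGD is a
localization of `R`. -/
def GradedGloballyPerinormal (𝒜 : ι → AddSubgroup R) : Prop :=
  ∀ S : Subalgebra R (FractionRing R),
    IsGradedOverring 𝒜 S → GGD 𝒜 S → IsLocalizationOfR S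

/-- The homogeneous localization `R_(P)` of `R` at an ideal `P`: the subring of the graded
quotient field consisting of fractions with homogeneous denominator outside `P`. -/
def HomLocR (𝒜 : ι → AddSubgroup R) (P : Ideal R) : Subalgebra R (FractionRing R) :=
  Algebra.adjoin R {x : FractionRing R | ∃ a w : R, SetLike.IsHomogeneousElem 𝒜 w ∧ w ∉ P ∧
    x * algebraMap R (FractionRing R) w = algebraMap R (FractionRing R) a}

/-- The homogeneous localization `S_(Q)` of an overring `S` at an ideal `Q` of `S`. -/
def HomLocOver (𝒜 : ι → AddSubgroup R) (S : Subalgebra R (FractionRing R)) (Q : Ideal S) :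
    Subalgebra R (FractionRing R) :=
  Algebra.adjoin R {x : FractionRing R | ∃ s w : S, IsHomFrac 𝒜 (w : FractionRing R) ∧
    w ∉ Q ∧ x * (w : FractionRing R) = (s : FractionRing R)}

/-- The localization `R_W` of `R` at a multiplicative set `W`, as a subring of the quotient
field. -/
def LocW (W : Submonoid R) : Subalgebra R (FractionRing R) :=
  Algebra.adjoin R {x : FractionRing R | ∃ r : R, ∃ w ∈ W,
    x * algebraMap R (FractionRing R) w = algebraMap R (FractionRing R) r}

/-- A subring `V` of the graded quotient field (containing `R`) is a gr-valuation domain: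
for every nonzero homogeneous `x` of the graded quotient field, `x ∈ V` or `x⁻¹ ∈ V`. -/
def GrValuation (𝒜 : ι → AddSubgroup R) (V : Subalgebra R (FractionRing R)) : Prop :=
  ∀ x : FractionRing R, x ≠ 0 → IsHomFrac 𝒜 x → x ∈ V ∨ x⁻¹ ∈ V

/-- `R` is a gr-(R₁) domain: the homogeneous localization at every height-one homogeneous
prime is a gr-valuation domain. -/
def GrR1 (𝒜 : ι → AddSubgroup R) : Prop :=
  ∀ P : Ideal R, HeightOnePrime P → IsHomIdeal 𝒜 P → GrValuation 𝒜 (HomLocR 𝒜 P)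

/-- The ideal `I` of `T` is the contraction of the ideal `J` of `S` (that is, `I = J ∩ T`
inside the common quotient field). -/
def Contracts (T S : Subalgebra R (FractionRing R)) (J : Ideal S) (I : Ideal T) : Prop :=
  ∀ x : FractionRing R,
    (∃ h : x ∈ T, (⟨x, h⟩ : T) ∈ I) ↔ (x ∈ T ∧ ∃ h : x ∈ S, (⟨x, h⟩ : S) ∈ J)

/-- `S` satisfies graded going-down over the intermediate ring `T`. -/
def GGDSub (𝒜 : ι → AddSubgroup R) (T S : Subalgebra R (FractionRing R)) : Prop :=
  ∀ (P Q : Ideal T) (Qt : Ideal S), P.IsPrime → Q.IsPrime → Qt.IsPrime →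
    IsHomIdealOver 𝒜 T P → IsHomIdealOver 𝒜 T Q → IsHomIdealOver 𝒜 S Qt → P ≤ Q →
    Contracts T S Qt Q →
    ∃ Pt : Ideal S, Pt.IsPrime ∧ IsHomIdealOver 𝒜 S Pt ∧ Pt ≤ Qt ∧ Contracts T S Pt P

/-- `S` is a localization of the intermediate ring `T` at a multiplicative subset of `T`. -/
def IsLocalizationOfSub (T S : Subalgebra R (FractionRing R)) : Prop :=
  ∃ W : Submonoid (FractionRing R), (W : Set (FractionRing R)) ⊆ T ∧
    (∀ w ∈ W, ∃ y ∈ S, w * y = 1) ∧ ∀ s ∈ S, ∃ t ∈ T, ∃ w ∈ W, s * w = t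

/-- The intermediate ring `T` (e.g. a homogeneous localization of `R`) is a graded
perinormal domain. -/
def GradedPerinormalSub (𝒜 : ι → AddSubgroup R) (T : Subalgebra R (FractionRing R)) : Prop :=
  ∀ S : Subalgebra R (FractionRing R), T ≤ S → IsGradedOverring 𝒜 S → GrLocalOver 𝒜 S →
    GGDSub 𝒜 T S → IsLocalizationOfSub T S

/-- The intermediate ring `T` is a graded globally perinormal domain. -/
def GradedGloballyPerinormalSub (𝒜 : ι → AddSubgroup R)
    (T : Subalgebra R (FractionRing R)) : Prop :=
  ∀ S : Subalgebra R (FractionRing R), T ≤ S → IsGradedOverring 𝒜 S →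
    GGDSub 𝒜 T S → IsLocalizationOfSub T S

/-- `R` is a gr-essential domain: `R` is the intersection of homogeneous localizations at a
family of homogeneous primes, each of which is a gr-valuation domain. -/
def GrEssential (𝒜 : ι → AddSubgroup R) : Prop :=
  ∃ I : Set (Ideal R),
    (∀ P ∈ I, P.IsPrime ∧ IsHomIdeal 𝒜 P ∧ GrValuation 𝒜 (HomLocR 𝒜 P)) ∧
    ((⊥ : Subalgebra R (FractionRing R)) : Set (FractionRing R)) =
      ⋂ P ∈ I, (HomLocR 𝒜 P : Set (FractionRing R))

/-- The intermediate ring `T` is a gr-essential domain. -/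
def GrEssentialSub (𝒜 : ι → AddSubgroup R) (T : Subalgebra R (FractionRing R)) : Prop :=
  ∃ I : Set (Ideal T),
    (∀ P ∈ I, P.IsPrime ∧ IsHomIdealOver 𝒜 T P ∧ GrValuation 𝒜 (HomLocOver 𝒜 T P)) ∧
    (T : Set (FractionRing R)) = ⋂ P ∈ I, (HomLocOver 𝒜 T P : Set (FractionRing R))

end Core

section Grading

variable {G : Type*} {R : Type*} [CommRing R] {𝒜 : G → AddSubgroup R}

/-- A property of ideals stable under unions of nonempty chains has, above each proper ideal
satisfying it, a maximal proper ideal satisfying it. -/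
theorem exists_le_maximal_proper_ideal {A : Type*} [CommRing A] (p : Ideal A → Prop)
    (hp : ∀ c : Set (Ideal A), c.Nonempty → IsChain (· ≤ ·) c → (∀ J ∈ c, p J) → p (sSup c))
    (I : Ideal A) (hI : p I) (hI' : I ≠ ⊤) :
    ∃ M, I ≤ M ∧ p M ∧ M ≠ ⊤ ∧ ∀ J, p J → M ≤ J → J ≠ ⊤ → J = M := by
  obtain ⟨M, hIM, hM⟩ := zorn_le_nonempty₀ {J : Ideal A | p J ∧ J ≠ ⊤} (fun c hc hch y hy => by
    refine ⟨sSup c, ⟨hp c ⟨y, hy⟩ hch fun J hJ => (hc hJ).1, fun htop => ?_⟩,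
      fun z hz => le_sSup hz⟩
    have h1 : (1 : A) ∈ sSup c := htop ▸ Submodule.mem_top
    obtain ⟨J, hJ, h1J⟩ := (Submodule.mem_sSup_of_directed ⟨y, hy⟩ hch.directedOn).1 h1
    exact (hc hJ).2 ((Ideal.eq_top_iff_one J).2 h1J)) I ⟨hI, hI'⟩
  exact ⟨M, hIM, hM.prop.1, hM.prop.2, fun J hJ hMJ hJt => (hM.eq_of_le ⟨hJ, hJt⟩ hMJ).symm⟩

theorem exists_le_isGrMaxIdeal (I : Ideal R) (hI : IsHomIdeal 𝒜 I) (hI' : I ≠ ⊤) :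
    ∃ M, I ≤ M ∧ IsGrMaxIdeal 𝒜 M := by
  refine exists_le_maximal_proper_ideal (IsHomIdeal 𝒜) (fun c hne hch hc x hx => ?_) I hI hI'
  obtain ⟨J, hJ, hxJ⟩ := (Submodule.mem_sSup_of_directed hne hch.directedOn).1 hx
  refine AddSubmonoid.closure_mono ?_ (hc J hJ x hxJ)
  exact fun y hy => ⟨hy.1, le_sSup hJ hy.2⟩

theorem exists_le_isGrMaxIdealOver {S : Subalgebra R (FractionRing R)} (I : Ideal S)
    (hI : IsHomIdealOver 𝒜 S I) (hI' : I ≠ ⊤) : ∃ M, I ≤ M ∧ IsGrMaxIdealOver 𝒜 S M := by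
  refine exists_le_maximal_proper_ideal (IsHomIdealOver 𝒜 S) (fun c hne hch hc x hx => ?_) I hI hI'
  obtain ⟨J, hJ, hxJ⟩ := (Submodule.mem_sSup_of_directed hne hch.directedOn).1 hx
  refine AddSubmonoid.closure_mono ?_ (hc J hJ x hxJ)
  exact fun y hy => ⟨hy.1, hy.2.1, le_sSup hJ hy.2.2⟩

variable [DecidableEq G] [AddCommGroup G]

/-- The `GradedRing` structure on a ring graded in the sense of `IsGrRing`. -/
noncomputable abbrev IsGrRing.gradedRing (hGr : IsGrRing 𝒜) : GradedRing 𝒜 where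
  one_mem := hGr.one_mem
  mul_mem _ _ _ _ ha hb := hGr.mul_mem ha hb
  toDecomposition := hGr.internal.chooseDecomposition

variable [IsDomain R]

theorem isHomFrac_algebraMap (hGr : IsGrRing 𝒜) {a : R} (ha : SetLike.IsHomogeneousElem 𝒜 a) :
    IsHomFrac 𝒜 (algebraMap R (FractionRing R) a) :=
  let ⟨i, hi⟩ := ha
  ⟨i, 0, a, 1, hi, hGr.one_mem, one_ne_zero, by simp⟩

theorem IsHomFrac.mul (hGr : IsGrRing 𝒜) {x y : FractionRing R} (hx : IsHomFrac 𝒜 x)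
    (hy : IsHomFrac 𝒜 y) : IsHomFrac 𝒜 (x * y) := by
  obtain ⟨i, j, a, b, ha, hb, hb0, h⟩ := hx
  obtain ⟨i', j', a', b', ha', hb', hb0', h'⟩ := hy
  refine ⟨i + i', j + j', a * a', b * b', hGr.mul_mem ha ha', hGr.mul_mem hb hb',
    mul_ne_zero hb0 hb0', ?_⟩
  rw [map_mul, map_mul, ← h, ← h']
  ring

/-- If an element of `R` is a sum of homogeneous fractions lying in an additive submonoid `A`,
then its homogeneous components lie in `A`. -/
theorem algebraMap_decompose_mem_of_mem_closure (hGr : IsGrRing 𝒜) [GradedRing 𝒜]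
    (A : AddSubmonoid (FractionRing R)) {x : R}
    (hx : algebraMap R (FractionRing R) x ∈ AddSubmonoid.closure {y | IsHomFrac 𝒜 y ∧ y ∈ A})
    (i : G) : algebraMap R (FractionRing R) (DirectSum.decompose 𝒜 x i : R) ∈ A := by
  have key : ∀ z ∈ AddSubmonoid.closure {y | IsHomFrac 𝒜 y ∧ y ∈ A},
      ∃ (j : G) (b r : R), b ∈ 𝒜 j ∧ b ≠ 0 ∧
        algebraMap R (FractionRing R) r = algebraMap R (FractionRing R) b * z ∧
        ∀ k, ∃ y ∈ A, algebraMap R (FractionRing R) (DirectSum.decompose 𝒜 r k : R) =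
          algebraMap R (FractionRing R) b * y := by
    intro z hz
    induction hz using AddSubmonoid.closure_induction with
    | mem z hz =>
      obtain ⟨⟨l, j, a, b, ha, hb, hb0, h⟩, hzA⟩ := hz
      refine ⟨j, b, a, hb, hb0, by rw [← h, mul_comm], fun k => ?_⟩
      by_cases hk : l = k
      · subst hk
        exact ⟨z, hzA, by rw [DirectSum.decompose_of_mem_same _ ha, ← h, mul_comm]⟩
      · exact ⟨0, zero_mem A, by rw [DirectSum.decompose_of_mem_ne _ ha hk]; simp⟩
    | zero =>
      exact ⟨0, 1, 0, hGr.one_mem, one_ne_zero, by simp, fun k => ⟨0, zero_mem A, by simp⟩⟩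
    | add z z' _ _ ih ih' =>
      obtain ⟨j, b, r, hb, hb0, hr, H⟩ := ih
      obtain ⟨j', b', r', hb', hb0', hr', H'⟩ := ih'
      refine ⟨j + j', b * b', b' * r + b * r', hGr.mul_mem hb hb', mul_ne_zero hb0 hb0', ?_,
        fun k => ?_⟩
      · simp only [map_add, map_mul, hr, hr']
        ring
      · obtain ⟨y, hy, e⟩ := H (k - j')
        obtain ⟨y', hy', e'⟩ := H' (k - j)
        refine ⟨y + y', add_mem hy hy', ?_⟩
        have h1 := DirectSum.coe_decompose_mul_add_of_left_mem 𝒜 (j := k - j') (b := r) hb'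
        have h2 := DirectSum.coe_decompose_mul_add_of_left_mem 𝒜 (j := k - j) (b := r') hb
        rw [add_sub_cancel] at h1 h2
        rw [DirectSum.decompose_add, DirectSum.add_apply, AddMemClass.coe_add, h1, h2, map_add,
          map_mul, map_mul, e, e', map_mul]
        ring
  obtain ⟨j, b, r, hb, hb0, hr, H⟩ := key _ hx
  rw [← map_mul] at hr
  obtain rfl := FaithfulSMul.algebraMap_injective R (FractionRing R) hr
  obtain ⟨y, hy, e⟩ := H (j + i)
  rw [DirectSum.coe_decompose_mul_add_of_left_mem 𝒜 hb, map_mul] at e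
  have hb' : algebraMap R (FractionRing R) b ≠ 0 := by simpa using hb0
  rwa [mul_left_cancel₀ hb' e]

theorem IsHomIdealOver.comap_algebraMap (hGr : IsGrRing 𝒜) {S : Subalgebra R (FractionRing R)}
    {I : Ideal S} (hI : IsHomIdealOver 𝒜 S I) : IsHomIdeal 𝒜 (I.comap (algebraMap R S)) := by
  classical
  let _ := hGr.gradedRing
  intro x hx
  rw [← DirectSum.sum_support_decompose 𝒜 x]
  refine sum_mem fun i _ => AddSubmonoid.subset_closure
    ⟨⟨i, (DirectSum.decompose 𝒜 x i).2⟩, ?_⟩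
  obtain ⟨y, hy, e⟩ := algebraMap_decompose_mem_of_mem_closure hGr
    (I.toAddSubmonoid.map S.val.toRingHom.toAddMonoidHom) (x := x)
    (by
      refine AddSubmonoid.closure_mono ?_ (hI _ hx)
      exact fun y hy => ⟨hy.1, ⟨y, hy.2.1⟩, hy.2.2, rfl⟩) i
  have : y = algebraMap R S (DirectSum.decompose 𝒜 x i : R) := Subtype.ext e
  rw [Ideal.mem_comap, ← this]
  exact hy

/-- In a gr-local graded overring, a homogeneous element outside the graded maximal ideal is a
unit. -/
theorem isUnit_of_notMem_of_isHomFrac (hGr : IsGrRing 𝒜) {S : Subalgebra R (FractionRing R)}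
    (hS : IsGradedOverring 𝒜 S) {M : Ideal S} (hM : ∀ I, IsGrMaxIdealOver 𝒜 S I → I = M) {s : S}
    (hs : IsHomFrac 𝒜 (s : FractionRing R)) (hsM : s ∉ M) : IsUnit s := by
  by_contra hu
  obtain ⟨N, hN, hNmax⟩ := exists_le_isGrMaxIdealOver (𝒜 := 𝒜) (Ideal.span {s}) (fun x hx => by
    obtain ⟨t, rfl⟩ := Ideal.mem_span_singleton'.1 hx
    have key : ∀ z ∈ AddSubmonoid.closure {y : FractionRing R | y ∈ S ∧ IsHomFrac 𝒜 y},
        z * s ∈ AddSubmonoid.closure {y : FractionRing R | IsHomFrac 𝒜 y ∧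
          ∃ h : y ∈ S, (⟨y, h⟩ : S) ∈ Ideal.span {s}} := by
      intro z hz
      induction hz using AddSubmonoid.closure_induction with
      | mem z hz =>
        exact AddSubmonoid.subset_closure ⟨hz.2.mul hGr hs, mul_mem hz.1 s.2,
          Ideal.mem_span_singleton'.2 ⟨⟨z, hz.1⟩, rfl⟩⟩
      | zero => rw [zero_mul]; exact zero_mem _
      | add z z' _ _ ih ih' => rw [add_mul]; exact add_mem ih ih'
    exact key t (hS t t.2)) (mt Ideal.span_singleton_eq_top.1 hu)
  exact hsM (hM N hNmax ▸ hN (Ideal.mem_span_singleton_self s))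

end Grading

section LocW

variable {R : Type*} [CommRing R]

theorem contracts_iff {T S : Subalgebra R (FractionRing R)} (hTS : T ≤ S) {J : Ideal S}
    {I : Ideal T} : Contracts T S J I ↔ I = J.comap (Subalgebra.inclusion hTS) := by
  refine ⟨fun h => Ideal.ext fun x => ⟨fun hx => ((h x).1 ⟨x.2, hx⟩).2.2,
    fun hx => ((h x).2 ⟨x.2, hTS x.2, hx⟩).2⟩, ?_⟩
  rintro rfl x
  exact ⟨fun ⟨hT, hx⟩ => ⟨hT, hTS hT, hx⟩, fun ⟨hT, _, hx⟩ => ⟨hT, hx⟩⟩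

/-- An overring of `T` that is a localization of `R` is a localization of `T`. -/
theorem IsLocalizationOfR.isLocalizationOfSub {T S : Subalgebra R (FractionRing R)}
    (h : IsLocalizationOfR S) : IsLocalizationOfSub T S := by
  obtain ⟨V, hV, hS⟩ := h
  refine ⟨V.map (algebraMap R (FractionRing R)), ?_, ?_, fun s hs => ?_⟩
  · rintro _ ⟨v, -, rfl⟩
    exact T.algebraMap_mem v
  · rintro _ ⟨v, hv, rfl⟩
    obtain ⟨y, hy⟩ := (hV v hv).exists_right_inv
    exact ⟨y, y.2, congrArg Subtype.val hy⟩
  · obtain ⟨r, w, hw, e⟩ := hS ⟨s, hs⟩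
    exact ⟨_, T.algebraMap_mem r, _, ⟨w, hw, rfl⟩, congrArg Subtype.val e⟩

theorem LocW_le {W : Submonoid R} {S : Subalgebra R (FractionRing R)}
    (h : ∀ w ∈ W, IsUnit (algebraMap R S w)) : LocW W ≤ S := by
  refine Algebra.adjoin_le ?_
  rintro x ⟨r, w, hw, e⟩
  obtain ⟨y, hy⟩ := (h w hw).exists_right_inv
  have hy' : algebraMap R (FractionRing R) w * y = 1 := congrArg Subtype.val hy
  have hx : x = algebraMap R (FractionRing R) r * y := by rw [← e, mul_assoc, hy', mul_one]
  rw [hx]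
  exact mul_mem (S.algebraMap_mem r) y.2

variable [IsDomain R]

/-- The homogeneous localization `R_(P)` inverts the multiplicative set generated by the
homogeneous elements outside `P`. -/
theorem HomLocR_eq_LocW {ι : Type*} (𝒜 : ι → AddSubgroup R) (P : Ideal R) :
    HomLocR 𝒜 P = LocW (Submonoid.closure {w : R | SetLike.IsHomogeneousElem 𝒜 w ∧ w ∉ P}) := by
  refine le_antisymm (Algebra.adjoin_mono ?_) (Algebra.adjoin_le ?_)
  · rintro x ⟨a, w, hw, hwP, e⟩
    exact ⟨a, w, Submonoid.subset_closure ⟨hw, hwP⟩, e⟩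
  · rintro x ⟨r, w, hw, e⟩
    have hw0 : w ≠ 0 ∧ (algebraMap R (FractionRing R) w)⁻¹ ∈ HomLocR 𝒜 P := by
      clear e
      induction hw using Submonoid.closure_induction with
      | mem w hw =>
        have hw0 : w ≠ 0 := fun h => hw.2 (h ▸ P.zero_mem)
        exact ⟨hw0, Algebra.subset_adjoin ⟨1, w, hw.1, hw.2, by
          rw [map_one, inv_mul_cancel₀ (by simpa using hw0)]⟩⟩
      | one => simp
      | mul w w' _ _ ih ih' =>
        refine ⟨mul_ne_zero ih.1 ih'.1, ?_⟩
        rw [map_mul, mul_inv]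
        exact mul_mem ih.2 ih'.2
    have hx : x = algebraMap R (FractionRing R) r * (algebraMap R (FractionRing R) w)⁻¹ := by
      rw [← e, mul_inv_cancel_right₀ (by simpa using hw0.1)]
    rw [hx]
    exact mul_mem (Subalgebra.algebraMap_mem _ r) hw0.2

theorem LocW_eq_ofField (W : Submonoid R) (hW : W ≤ nonZeroDivisors R) :
    LocW W = Localization.subalgebra.ofField (FractionRing R) W hW := by
  have key : ∀ x : FractionRing R, x ∈ Localization.subalgebra.ofField (FractionRing R) W hW ↔
      ∃ r : R, ∃ w ∈ W, x * algebraMap R (FractionRing R) w = algebraMap R (FractionRing R) r := by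
    intro x
    change (∃ (a s : R) (_ : s ∈ W), _) ↔ _
    refine exists_congr fun a => exists_congr fun w => ?_
    rw [exists_prop]
    refine and_congr_right fun hw => ?_
    have hw0 : algebraMap R (FractionRing R) w ≠ 0 := by
      simpa using nonZeroDivisors.ne_zero (hW hw)
    rw [← div_eq_mul_inv, eq_div_iff hw0]
  refine le_antisymm (Algebra.adjoin_le fun x hx => (key x).2 hx) fun x hx => ?_
  exact Algebra.subset_adjoin ((key x).1 hx)

theorem isLocalization_LocW {W : Submonoid R} (hW : W ≤ nonZeroDivisors R) :
    IsLocalization W (LocW W) := by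
  rw [LocW_eq_ofField W hW]
  infer_instance

theorem isUnit_algebraMap_of_LocW_le {W : Submonoid R} (hW : W ≤ nonZeroDivisors R)
    {S : Subalgebra R (FractionRing R)} (hTS : LocW W ≤ S) {w : R} (hw : w ∈ W) :
    IsUnit (algebraMap R S w) :=
  have := isLocalization_LocW hW
  (IsLocalization.map_units (LocW W) ⟨w, hw⟩).map (Subalgebra.inclusion hTS)

/-- A localization of `R_W` is a localization of `R`. -/
theorem IsLocalizationOfSub.isLocalizationOfR {W : Submonoid R} (hW : W ≤ nonZeroDivisors R)
    {S : Subalgebra R (FractionRing R)} (hTS : LocW W ≤ S)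
    (h : IsLocalizationOfSub (LocW W) S) : IsLocalizationOfR S := by
  have := isLocalization_LocW hW
  obtain ⟨V, hVT, hV, hS⟩ := h
  refine ⟨(IsUnit.submonoid S).comap (algebraMap R S), fun w hw => hw, fun s => ?_⟩
  obtain ⟨t, ht, v, hv, e⟩ := hS s s.2
  obtain ⟨⟨a, w⟩, ha⟩ := IsLocalization.surj W (⟨t, ht⟩ : LocW W)
  obtain ⟨⟨b, u⟩, hb⟩ := IsLocalization.surj W (⟨v, hVT hv⟩ : LocW W)
  have hw := isUnit_algebraMap_of_LocW_le hW hTS w.2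
  have hu := isUnit_algebraMap_of_LocW_le hW hTS u.2
  have ha' : t * algebraMap R (FractionRing R) w = algebraMap R (FractionRing R) a :=
    congrArg Subtype.val ha
  have hb' : v * algebraMap R (FractionRing R) u = algebraMap R (FractionRing R) b :=
    congrArg Subtype.val hb
  obtain ⟨y, hy, hvy⟩ := hV v hv
  have hvu : IsUnit (⟨v, hTS (hVT hv)⟩ : S) :=
    IsUnit.of_mul_eq_one ⟨y, hy⟩ (Subtype.ext hvy)
  refine ⟨a * u, b * w, ?_, Subtype.ext ?_⟩
  · have hb'' : algebraMap R S b = ⟨v, hTS (hVT hv)⟩ * algebraMap R S u := Subtype.ext hb'.symm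
    change IsUnit (algebraMap R S (b * w))
    rw [map_mul, hb'']
    exact (hvu.mul hu).mul hw
  · change (s : FractionRing R) * algebraMap R (FractionRing R) (b * w) =
      algebraMap R (FractionRing R) (a * u)
    rw [map_mul, map_mul, ← ha', ← hb', ← e]
    ring

variable {G : Type*} {𝒜 : G → AddSubgroup R}

/-- An ideal of `R_W` is homogeneous as soon as its contraction to `R` is. -/
theorem isHomIdealOver_LocW {W : Submonoid R}
    (hW : ∀ w ∈ W, w ≠ 0 ∧ SetLike.IsHomogeneousElem 𝒜 w) {J : Ideal (LocW W)}
    (hJ : IsHomIdeal 𝒜 (J.comap (algebraMap R (LocW W)))) : IsHomIdealOver 𝒜 (LocW W) J := by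
  have := isLocalization_LocW fun w hw => mem_nonZeroDivisors_of_ne_zero (hW w hw).1
  intro x hx
  obtain ⟨⟨r, w⟩, e⟩ := IsLocalization.surj W x
  obtain ⟨hw0, j, hj⟩ := hW w w.2
  obtain ⟨v, hv⟩ := (IsLocalization.map_units (LocW W) w).exists_right_inv
  have key : ∀ r ∈ AddSubmonoid.closure {y : R | SetLike.IsHomogeneousElem 𝒜 y ∧
      y ∈ J.comap (algebraMap R (LocW W))}, ((algebraMap R (LocW W) r * v : LocW W) :
        FractionRing R) ∈ AddSubmonoid.closure {y : FractionRing R | IsHomFrac 𝒜 y ∧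
          ∃ h : y ∈ LocW W, (⟨y, h⟩ : LocW W) ∈ J} := by
    intro r hr
    induction hr using AddSubmonoid.closure_induction with
    | mem r hr =>
      obtain ⟨⟨i, hi⟩, hrJ⟩ := hr
      refine AddSubmonoid.subset_closure ⟨⟨i, j, r, w, hi, hj, hw0, ?_⟩, Subtype.property _,
        J.mul_mem_right v hrJ⟩
      have : algebraMap R (LocW W) r * v * algebraMap R (LocW W) w = algebraMap R (LocW W) r := by
        rw [mul_assoc, mul_comm v, hv, mul_one]
      exact congrArg Subtype.val this
    | zero => simp
    | add r r' _ _ ih ih' =>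
      rw [map_add, add_mul]
      exact add_mem ih ih'
  have hxr : x = algebraMap R (LocW W) r * v := by rw [← e, mul_assoc, hv, mul_one]
  rw [hxr]
  refine key r (hJ r ?_)
  rw [Ideal.mem_comap, ← e]
  exact J.mul_mem_right _ hx

/-- Graded going-down over `R` passes to graded going-down over `R_W`. -/
theorem GGD.ggdSub_LocW [DecidableEq G] [AddCommGroup G] (hGr : IsGrRing 𝒜) {W : Submonoid R}
    (hW : W ≤ nonZeroDivisors R) {S : Subalgebra R (FractionRing R)} (hTS : LocW W ≤ S) (h : GGD 𝒜 S) :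
    GGDSub 𝒜 (LocW W) S := by
  have := isLocalization_LocW hW
  intro P Q Qt hP hQ hQt hPh hQh hQth hPQ hc
  rw [contracts_iff hTS] at hc
  obtain ⟨Pt, hPt, hPth, hle, e⟩ := h (P.comap (algebraMap R (LocW W)))
    (Q.comap (algebraMap R (LocW W))) Qt inferInstance inferInstance hQt
    (hPh.comap_algebraMap hGr) (hQh.comap_algebraMap hGr) hQth (Ideal.comap_mono hPQ)
    (by rw [hc]; rfl)
  refine ⟨Pt, hPt, hPth, hle, (contracts_iff hTS).2 ?_⟩
  rw [← IsLocalization.map_under W (LocW W) P,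
    ← IsLocalization.map_under W (LocW W) (Pt.comap _)]
  exact congrArg (Ideal.map (algebraMap R (LocW W))) e.symm

/-- Graded going-down over `R_W` implies graded going-down over `R`. -/
theorem GGDSub.ggd_of_LocW {W : Submonoid R}
    (hW : ∀ w ∈ W, w ≠ 0 ∧ SetLike.IsHomogeneousElem 𝒜 w)
    {S : Subalgebra R (FractionRing R)} (hTS : LocW W ≤ S) (h : GGDSub 𝒜 (LocW W) S) :
    GGD 𝒜 S := by
  have hW0 : W ≤ nonZeroDivisors R := fun w hw => mem_nonZeroDivisors_of_ne_zero (hW w hw).1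
  have := isLocalization_LocW hW0
  intro P Q Qt hP hQ hQt hPh hQh hQth hPQ hc
  have hd : Disjoint (W : Set R) P := Set.disjoint_left.2 fun w hw hwP => hQt.ne_top <|
    Ideal.eq_top_of_isUnit_mem _ (hc.ge (hPQ hwP)) (isUnit_algebraMap_of_LocW_le hW0 hTS hw)
  have hPc : (P.map (algebraMap R (LocW W))).comap (algebraMap R (LocW W)) = P :=
    IsLocalization.under_map_of_isPrime_disjoint W (LocW W) hP hd
  have hQc : (Qt.comap (Subalgebra.inclusion hTS)).comap (algebraMap R (LocW W)) = Q := hc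
  obtain ⟨Pt, hPt, hPth, hle, e⟩ := h (P.map (algebraMap R (LocW W)))
    (Qt.comap (Subalgebra.inclusion hTS)) Qt
    (IsLocalization.isPrime_of_isPrime_disjoint W (LocW W) P hP hd) inferInstance hQt
    (isHomIdealOver_LocW hW (by rwa [hPc])) (isHomIdealOver_LocW hW (by rwa [hQc])) hQth
    (Ideal.map_le_iff_le_comap.2 (by rwa [hQc])) ((contracts_iff hTS).2 rfl)
  refine ⟨Pt, hPt, hPth, hle, ?_⟩
  rw [← hPc, (contracts_iff hTS).1 e]
  rfl

end LocW

/-- Let `R` be a `G`-graded domain. If `R_(𝔪)` is a graded perinormal domain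
for every graded maximal ideal `𝔪` of `R`, then `R` is a graded perinormal domain.  Conversely,
if `R` is a graded perinormal domain, then `R_W` is a graded perinormal domain for every
multiplicative subset `W` of `R` consisting of (nonzero) homogeneous elements. -/
theorem gradedPerinormal_of_homLoc_and_localization
    {G : Type*} [DecidableEq G] [AddCommGroup G] (hG : ∀ g : G, g ≠ 0 → ¬IsOfFinAddOrder g)
    {R : Type*} [CommRing R] [IsDomain R]
    (𝒜 : G → AddSubgroup R) (hGr : IsGrRing 𝒜) :
    ((∀ 𝔪 : Ideal R, IsGrMaxIdeal 𝒜 𝔪 → GradedPerinormalSub 𝒜 (HomLocR 𝒜 𝔪)) →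
        GradedPerinormal 𝒜) ∧
    (GradedPerinormal 𝒜 →
      ∀ W : Submonoid R, (∀ w ∈ W, w ≠ 0 ∧ SetLike.IsHomogeneousElem 𝒜 w) →
        GradedPerinormalSub 𝒜 (LocW W)) := by
  refine ⟨fun H S hS ⟨M, hM, hMu⟩ hgd => ?_, fun H W hW S hTS hS hloc hgd => ?_⟩
  · obtain ⟨𝔪, hle, h𝔪⟩ := exists_le_isGrMaxIdeal _ (hM.1.comap_algebraMap hGr)
      (Ideal.comap_ne_top (algebraMap R S) hM.2.1)
    have hT := HomLocR_eq_LocW 𝒜 𝔪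
    set W := Submonoid.closure {w : R | SetLike.IsHomogeneousElem 𝒜 w ∧ w ∉ 𝔪}
    have hW : W ≤ nonZeroDivisors R := (Submonoid.closure_le).2 fun w hw =>
      mem_nonZeroDivisors_of_ne_zero fun h => hw.2 (h ▸ 𝔪.zero_mem)
    have hu : W ≤ (IsUnit.submonoid S).comap (algebraMap R S) :=
      (Submonoid.closure_le).2 fun w hw => isUnit_of_notMem_of_isHomFrac hGr hS hMu
        (isHomFrac_algebraMap hGr hw.1) fun h => hw.2 (hle h)
    have hTS : LocW W ≤ S := LocW_le fun w hw => hu hw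
    have hper := H 𝔪 h𝔪
    rw [hT] at hper
    exact (hper S hTS hS ⟨M, hM, hMu⟩ (hgd.ggdSub_LocW hGr hW hTS)).isLocalizationOfR hW hTS
  · exact (H S hS hloc (hgd.ggd_of_LocW hW hTS)).isLocalizationOfSub
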